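/- Fix w ∈ G and define the bijection g : G → G by g(x) = w⁻¹ · f₀(x) · w. If the image of the reachable set R under g⁻¹ is contained in R (that is, g⁻¹(R) ⊆ R), then w R w⁻¹ ⊆ R, i.e. w x w⁻¹ ∈ R for every x ∈ R. -/

import Mathlib

open Pointwise

/-- The solution of a discrete-time linear control system:
`phi f₀ b 0 x u = x`, `phi f₀ b (k+1) x u = b (u k) * f₀ (phi f₀ b k x u)`. -/
def phi {G : Type*} [Group G] {U : Type*} (f₀ : G ≃* G) (b : U → G) :
    ℕ → G → (ℕ → U) → G
  | 0, x, _ => x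
  | k + 1, x, u => b (u k) * f₀ (phi f₀ b k x u)

/-- The reachable set from `x` at time `k`. -/
def reach {G : Type*} [Group G] {U : Type*} (f₀ : G ≃* G) (b : U → G)
    (k : ℕ) (x : G) : Set G :=
  {y | ∃ u : ℕ → U, phi f₀ b k x u = y}

theorem phi_congr {G : Type*} [Group G] {U : Type*} (f₀ : G ≃* G) (b : U → G) (x : G)
    {u v : ℕ → U} {k : ℕ} (h : ∀ n < k, u n = v n) :
    phi f₀ b k x u = phi f₀ b k x v := by
  induction k with
  | zero => rfl
  | succ k ih =>
    simp only [phi]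
    rw [h k k.lt_succ_self, ih fun n hn => h n (hn.trans k.lt_succ_self)]

theorem mul_map_mem_reach_succ {G : Type*} [Group G] {U : Type*} (f₀ : G ≃* G) (b : U → G)
    {k : ℕ} {x y : G} (a : U) (hy : y ∈ reach f₀ b k x) :
    b a * f₀ y ∈ reach f₀ b (k + 1) x := by
  obtain ⟨u, rfl⟩ := hy
  refine ⟨Function.update u k a, ?_⟩
  rw [phi, Function.update_self,
    phi_congr f₀ b x fun n hn => Function.update_of_ne hn.ne a u]

/-- with g(x) = w⁻¹ f₀(x) w, if g⁻¹(R) ⊆ R then w R w⁻¹ ⊆ R.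
(The image of R under g⁻¹ is the preimage of R under the bijection g.) -/
theorem conj_reach_subset {G : Type*} [Group G] {U : Type*} [Zero U]
    (f₀ : G ≃* G) (b : U → G) (hb : b 0 = 1) (w : G)
    (hg : (fun x => w⁻¹ * f₀ x * w) ⁻¹' (⋃ k ≥ 1, reach f₀ b k 1) ⊆
      ⋃ k ≥ 1, reach f₀ b k 1) :
    ∀ x ∈ ⋃ k ≥ 1, reach f₀ b k 1, w * x * w⁻¹ ∈ ⋃ k ≥ 1, reach f₀ b k 1 := by
  intro x hx
  have hy : f₀.symm (w * x * w⁻¹) ∈ ⋃ k ≥ 1, reach f₀ b k 1 := by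
    apply hg
    simpa [mul_assoc] using hx
  simp only [Set.mem_iUnion] at hy ⊢
  obtain ⟨k, hk, hy⟩ := hy
  refine ⟨k + 1, by omega, ?_⟩
  simpa [hb] using mul_map_mem_reach_succ f₀ b 0 hy
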